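/- Let (s, ⟨·,·⟩) be a metric solvable Lie algebra with nilradical n and a = n^⊥. Then, for any A ∈ a, the following two conditions are equivalent: (i) the transpose (ad A)ᵗ is a derivation of s; (ii) ad A is a normal operator, i.e. [ad A, (ad A)ᵗ] = 0. -/

import Mathlib

noncomputable section

open scoped RealInnerProductSpace

/-! ### Lie-algebraic notions for a bracket given as a bundled bilinear map -/

section Alg

variable {E : Type*} [AddCommGroup E] [Module ℝ E]

/-- `μ` is a Lie bracket: alternating and satisfying the (Leibniz form of the) Jacobi identity. -/
def IsLieBracket (μ : E →ₗ[ℝ] E →ₗ[ℝ] E) : Prop :=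
  (∀ X, μ X X = 0) ∧ ∀ X Y Z, μ X (μ Y Z) = μ (μ X Y) Z + μ Y (μ X Z)

/-- `D` is a derivation of the algebra `(E, μ)`. -/
def IsDeriv (μ : E →ₗ[ℝ] E →ₗ[ℝ] E) (D : E →ₗ[ℝ] E) : Prop :=
  ∀ X Y, D (μ X Y) = μ (D X) Y + μ X (D Y)

/-- The subspace spanned by brackets of elements of `p` and `q`. -/
def bracketSpan (μ : E →ₗ[ℝ] E →ₗ[ℝ] E) (p q : Submodule ℝ E) : Submodule ℝ E :=
  Submodule.span ℝ {z | ∃ x ∈ p, ∃ y ∈ q, μ x y = z}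

/-- Derived series of `(E, μ)`. -/
def derSeries (μ : E →ₗ[ℝ] E →ₗ[ℝ] E) : ℕ → Submodule ℝ E
  | 0 => ⊤
  | k + 1 => bracketSpan μ (derSeries μ k) (derSeries μ k)

/-- `(E, μ)` is a solvable Lie algebra. -/
def IsSolvableB (μ : E →ₗ[ℝ] E →ₗ[ℝ] E) : Prop := ∃ k, derSeries μ k = ⊥

/-- Lower central series of the subalgebra `p` of `(E, μ)`. -/
def lcsOn (μ : E →ₗ[ℝ] E →ₗ[ℝ] E) (p : Submodule ℝ E) : ℕ → Submodule ℝ E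
  | 0 => p
  | k + 1 => bracketSpan μ p (lcsOn μ p k)

/-- The subalgebra `p` of `(E, μ)` is a nilpotent Lie algebra. -/
def IsNilpotentOn (μ : E →ₗ[ℝ] E →ₗ[ℝ] E) (p : Submodule ℝ E) : Prop := ∃ k, lcsOn μ p k = ⊥

/-- `p` is an ideal of `(E, μ)`. -/
def IsIdeal (μ : E →ₗ[ℝ] E →ₗ[ℝ] E) (p : Submodule ℝ E) : Prop := ∀ X : E, ∀ Y ∈ p, μ X Y ∈ p

/-- `p` is the nilradical (maximal nilpotent ideal) of `(E, μ)`. -/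
def IsNilradical (μ : E →ₗ[ℝ] E →ₗ[ℝ] E) (p : Submodule ℝ E) : Prop :=
  IsIdeal μ p ∧ IsNilpotentOn μ p ∧ ∀ q, IsIdeal μ q → IsNilpotentOn μ q → q ≤ p

/-- The natural action `π(f)μ` of `f ∈ End(E)` on bilinear maps:
`(π(f)μ)(X,Y) = f(μ(X,Y)) - μ(fX,Y) - μ(X,fY)`. -/
def piAct (f : E →ₗ[ℝ] E) (μ : E →ₗ[ℝ] E →ₗ[ℝ] E) : E →ₗ[ℝ] E →ₗ[ℝ] E :=
  (LinearMap.llcomp ℝ E E E f) ∘ₗ μ - μ ∘ₗ f - (LinearMap.lcomp ℝ E f) ∘ₗ μ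

/-- The center of `(E, μ)`. -/
def centerB (μ : E →ₗ[ℝ] E →ₗ[ℝ] E) : Submodule ℝ E where
  carrier := {X | μ X = 0}
  add_mem' := by intro a b ha hb; simp only [Set.mem_setOf_eq, map_add] at *; rw [ha, hb, add_zero]
  zero_mem' := by simp only [Set.mem_setOf_eq, map_zero]
  smul_mem' := by intro c a ha; simp only [Set.mem_setOf_eq, map_smul] at *; rw [ha, smul_zero]

end Alg

/-! ### Metric notions -/

section MetricDefs

variable {E : Type*} [NormedAddCommGroup E] [InnerProductSpace ℝ E] [FiniteDimensional ℝ E]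

/-- The transpose of an operator with respect to the inner product. -/
def transp (f : E →ₗ[ℝ] E) : E →ₗ[ℝ] E := LinearMap.adjoint f

/-- The symmetric part `S(f) = (f + fᵗ)/2` of an operator. -/
def symPart (f : E →ₗ[ℝ] E) : E →ₗ[ℝ] E := (1 / 2 : ℝ) • (f + transp f)

variable (E) in
/-- A fixed orthonormal basis of `E`. -/
def stdONB : OrthonormalBasis (Fin (Module.finrank ℝ E)) ℝ E := stdOrthonormalBasis ℝ E

/-- The operator `R` appearing in the formula for the Ricci operator of a metric Lie algebra:
`⟨R X, X⟩ = -(1/2) Σ ⟨[X,Xᵢ],Xⱼ⟩² + (1/4) Σ ⟨[Xᵢ,Xⱼ],X⟩²` for any orthonormal basis `{Xᵢ}`. -/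
def Rop (μ : E →ₗ[ℝ] E →ₗ[ℝ] E) : E →ₗ[ℝ] E :=
  (-(1 / 2 : ℝ)) • ∑ i, (transp (μ (stdONB E i))) ∘ₗ (μ (stdONB E i))
    + (1 / 4 : ℝ) • ∑ i, (μ (stdONB E i)) ∘ₗ (transp (μ (stdONB E i)))

/-- The symmetric operator `B` defined by the Killing form: `⟨B X, X⟩ = tr((ad X)²)`. -/
def Bop (μ : E →ₗ[ℝ] E →ₗ[ℝ] E) : E →ₗ[ℝ] E :=
  ∑ i, (((LinearMap.trace ℝ E) ∘ₗ (LinearMap.lcomp ℝ E (μ (stdONB E i))) ∘ₗ μ).smulRight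
    (stdONB E i))

/-- The mean curvature vector `H`, characterized by `⟨H, X⟩ = tr (ad X)`. -/
def meanCurv (μ : E →ₗ[ℝ] E →ₗ[ℝ] E) : E :=
  ∑ i, (LinearMap.trace ℝ E (μ (stdONB E i))) • (stdONB E i : E)

/-- The Ricci operator `Ric = R - (1/2) B - S(ad H)` of a metric Lie algebra. -/
def Ric (μ : E →ₗ[ℝ] E →ₗ[ℝ] E) : E →ₗ[ℝ] E :=
  Rop μ - (1 / 2 : ℝ) • Bop μ - symPart (μ (meanCurv μ))

/-- `(E, μ, ⟨⬝,⬝⟩)` is a solsoliton: `Ric = c I + D` for some `c ∈ ℝ` and derivation `D`. -/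
def IsSolsoliton (μ : E →ₗ[ℝ] E →ₗ[ℝ] E) : Prop :=
  ∃ (c : ℝ) (D : E →ₗ[ℝ] E), IsDeriv μ D ∧ Ric μ = c • LinearMap.id + D

/-- The natural inner product on bilinear maps, `⟨μ,ν⟩ = Σ ⟨μ(Xᵢ,Xⱼ), ν(Xᵢ,Xⱼ)⟩`. -/
def binner (μ ν : E →ₗ[ℝ] E →ₗ[ℝ] E) : ℝ :=
  ∑ i, ∑ j, ⟪μ (stdONB E i) (stdONB E j), ν (stdONB E i) (stdONB E j)⟫

/-- Orthogonal projection onto a subspace, as an endomorphism of `E`. -/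
def projL (p : Submodule ℝ E) : E →ₗ[ℝ] E :=
  p.subtype ∘ₗ (Submodule.orthogonalProjectionOnto p).toLinearMap

/-- An orthonormal basis of the subspace `p`, as a family of vectors of `E`. -/
def onbOf (p : Submodule ℝ E) : Fin (Module.finrank ℝ ↥p) → E :=
  fun i => ((stdOrthonormalBasis ℝ ↥p) i : E)

/-- The restriction `ad X |_p` of `ad X` to the subspace `p`, as an endomorphism of `E`
(it kills `pᗮ`). -/
def adOn (μ : E →ₗ[ℝ] E →ₗ[ℝ] E) (p : Submodule ℝ E) (X : E) : E →ₗ[ℝ] E :=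
  (μ X) ∘ₗ projL p

/-- The Ricci operator of the restricted metric Lie algebra `(p, μ|ₚ, ⟨⬝,⬝⟩|ₚ)`, for `p` a
bracket-closed subspace, realized as an endomorphism of `E` killing `pᗮ`.  (For `p` nilpotent
this is the full Ricci operator of `p`.) -/
def RopOn (μ : E →ₗ[ℝ] E →ₗ[ℝ] E) (p : Submodule ℝ E) : E →ₗ[ℝ] E :=
  (-(1 / 2 : ℝ)) • ∑ i, (transp (adOn μ p (onbOf p i))) ∘ₗ (adOn μ p (onbOf p i))
    + (1 / 4 : ℝ) • ∑ i, (adOn μ p (onbOf p i)) ∘ₗ (transp (adOn μ p (onbOf p i)))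

/-- The metric nilpotent Lie algebra `(p, μ|ₚ, ⟨⬝,⬝⟩|ₚ)` is a nilsoliton with Ricci operator
`c I + D₁`, where `D₁` is (induced by) a derivation of `p`. -/
def IsNilsolitonOn (μ : E →ₗ[ℝ] E →ₗ[ℝ] E) (p : Submodule ℝ E) (c : ℝ) (D₁ : E →ₗ[ℝ] E) :
    Prop :=
  (∀ X ∈ p, D₁ X ∈ p) ∧ (∀ X ∈ p, ∀ Y ∈ p, D₁ (μ X Y) = μ (D₁ X) Y + μ X (D₁ Y)) ∧
    ∀ X ∈ p, RopOn μ p X = c • X + D₁ X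

end MetricDefs

section LieTheory

open LieAlgebra LieModule TensorProduct

/-- Over an algebraically closed field of characteristic zero, elements of the derived ideal of a
solvable Lie algebra act nilpotently on every finite-dimensional module. -/
theorem isNilpotent_toEnd_of_mem_derivedSeries_of_isAlgClosed {K L : Type*} [Field K] [CharZero K]
    [IsAlgClosed K] [LieRing L] [LieAlgebra K L] [IsSolvable L] {x : L}
    (hx : x ∈ derivedSeries K L 1) (V : Type*) [AddCommGroup V] [Module K V] [LieRingModule L V]
    [LieModule K L V] [FiniteDimensional K V] : IsNilpotent (toEnd K L V x) := by
  induction h : Module.finrank K V using Nat.strong_induction_on generalizing V with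
  | _ d ih =>
  rcases subsingleton_or_nontrivial V with hV | hV
  · exact ⟨1, Subsingleton.elim _ _⟩
  obtain ⟨χ, hχ⟩ := exists_nontrivial_weightSpace_of_isSolvable K L V
  obtain ⟨⟨v, hv⟩, hv0⟩ := exists_ne (0 : weightSpace V χ)
  rw [mem_weightSpace] at hv
  have hv0 : v ≠ 0 := fun h0 ↦ hv0 (Subtype.ext h0)
  let N : LieSubmodule K L V :=
    { Submodule.span K {v} with
      lie_mem := by
        intro y m hm
        obtain ⟨c, rfl⟩ := Submodule.mem_span_singleton.mp hm
        rw [lie_smul, hv]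
        exact Submodule.smul_mem _ _ (Submodule.smul_mem _ _ (Submodule.mem_span_singleton_self v)) }
  have hlt : Module.finrank K (V ⧸ N) < d := by
    rw [← h]
    have hadd := Submodule.finrank_quotient_add_finrank N.toSubmodule
    have hspan : Module.finrank K N.toSubmodule = 1 := finrank_span_singleton hv0
    change Module.finrank K (V ⧸ N.toSubmodule) < _
    lia
  obtain ⟨k, hk⟩ := ih _ hlt (V ⧸ N) rfl
  have hχ0 : χ x = 0 := by
    have hx' : x ∈ (⁅(⊤ : LieIdeal K L), (⊤ : LieIdeal K L)⁆ : LieIdeal K L).toSubmodule := hx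
    rw [LieSubmodule.lieIdeal_oper_eq_linear_span'] at hx'
    refine (Submodule.span_le (p := LinearMap.ker χ)).mpr ?_ hx'
    rintro _ ⟨y, -, z, -, rfl⟩
    have h1 : ⁅⁅y, z⁆, v⁆ = 0 := by
      rw [lie_lie, hv, hv, lie_smul, lie_smul, hv, hv, smul_comm, sub_self]
    rw [hv] at h1
    simpa [hv0] using h1
  refine ⟨k + 1, LinearMap.ext fun m ↦ ?_⟩
  have hmk : ∀ (j : ℕ) (m : V), (((toEnd K L (V ⧸ N) x) ^ j) (LieSubmodule.Quotient.mk m : V ⧸ N))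
      = LieSubmodule.Quotient.mk (((toEnd K L V x) ^ j) m) := by
    intro j
    induction j with
    | zero => intro m; rfl
    | succ j ihj => intro m; rw [pow_succ, pow_succ]; exact ihj _
  have hm : ((toEnd K L V x) ^ k) m ∈ N := by
    refine (LieSubmodule.Quotient.mk_eq_zero (N := N)).mp ((hmk k m).symm.trans ?_)
    rw [hk]
    rfl
  obtain ⟨c, hc⟩ := Submodule.mem_span_singleton.mp hm
  rw [pow_succ', Module.End.mul_apply, ← hc, map_smul, toEnd_apply_apply, hv, hχ0]
  simp

/-- Over a field of characteristic zero, elements of the derived ideal of a solvable Lie algebra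
act nilpotently on every finite-dimensional module. -/
theorem isNilpotent_toEnd_of_mem_derivedSeries {K L V : Type*} [Field K] [CharZero K]
    [LieRing L] [LieAlgebra K L] [IsSolvable L] [AddCommGroup V] [Module K V] [LieRingModule L V]
    [LieModule K L V] [FiniteDimensional K V] {x : L} (hx : x ∈ derivedSeries K L 1) :
    IsNilpotent (toEnd K L V x) := by
  let F := AlgebraicClosure K
  have hxF : (1 : F) ⊗ₜ[K] x ∈ derivedSeries F (F ⊗[K] L) 1 := by
    rw [derivedSeries_baseChange]
    exact Submodule.tmul_mem_baseChange_of_mem 1 hx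
  have hinj : Function.Injective (Module.End.baseChangeHom K F V) :=
    LinearMap.baseChangeHom_injective K V F
  rw [← IsNilpotent.map_iff hinj]
  change IsNilpotent ((toEnd K L V x).baseChange F)
  rw [← toEnd_baseChange]
  exact isNilpotent_toEnd_of_mem_derivedSeries_of_isAlgClosed hxF _

/-- A finite-dimensional solvable Lie algebra in characteristic zero is a nilpotent module over
its derived ideal. -/
theorem isNilpotent_derivedSeries_one {K L : Type*} [Field K] [CharZero K]
    [LieRing L] [LieAlgebra K L] [IsSolvable L] [FiniteDimensional K L] :
    LieModule.IsNilpotent (derivedSeries K L 1) L :=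
  (LieModule.isNilpotent_iff_forall' (R := K)).mpr fun x ↦
    isNilpotent_toEnd_of_mem_derivedSeries (L := L) (x := x.1) x.2

end LieTheory

section Bracket

variable {E : Type*} [AddCommGroup E] [Module ℝ E] {μ : E →ₗ[ℝ] E →ₗ[ℝ] E}

/-- The Lie ring structure given by a bundled Lie bracket. -/
abbrev IsLieBracket.lieRing (h : IsLieBracket μ) : LieRing E where
  bracket x y := μ x y
  add_lie x y z := by simp
  lie_add x y z := by simp
  lie_self x := h.1 x
  leibniz_lie x y z := h.2 x y z

/-- The Lie algebra structure given by a bundled Lie bracket. -/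
abbrev IsLieBracket.lieAlgebra (h : IsLieBracket μ) :
    @LieAlgebra ℝ E _ h.lieRing :=
  letI := h.lieRing
  { lie_smul := fun t x y ↦ (μ x).map_smul t y }

theorem isIdeal_bracketSpan_top (μ : E →ₗ[ℝ] E →ₗ[ℝ] E) :
    IsIdeal μ (bracketSpan μ ⊤ ⊤) :=
  fun X Y _ ↦ Submodule.subset_span ⟨X, trivial, Y, trivial, rfl⟩

/-- The derived algebra of a finite-dimensional solvable Lie algebra is nilpotent. -/
theorem IsLieBracket.isNilpotentOn_bracketSpan_top [FiniteDimensional ℝ E] (h : IsLieBracket μ)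
    (hsolv : IsSolvableB μ) : IsNilpotentOn μ (bracketSpan μ ⊤ ⊤) := by
  let := h.lieRing
  let := h.lieAlgebra
  have hder : ∀ k, (LieAlgebra.derivedSeries ℝ E k).toSubmodule = derSeries μ k := by
    intro k
    induction k with
    | zero => rfl
    | succ k ih =>
      rw [LieAlgebra.derivedSeries_def, LieAlgebra.derivedSeriesOfIdeal_succ,
        LieSubmodule.lieIdeal_oper_eq_linear_span', derSeries, ← ih]
      rfl
  have : LieAlgebra.IsSolvable E := by
    obtain ⟨k, hk⟩ := hsolv
    refine LieAlgebra.IsSolvable.mk (R := ℝ) (k := k) ?_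
    rw [← LieSubmodule.toSubmodule_eq_bot, hder, hk]
  have hnil : LieModule.IsNilpotent (LieAlgebra.derivedSeries ℝ E 1) E :=
    isNilpotent_derivedSeries_one
  obtain ⟨k, hk⟩ := (LieModule.isNilpotent_iff ℝ _ _).mp hnil
  refine ⟨k, eq_bot_iff.mpr ?_⟩
  have hle : ∀ j, lcsOn μ (bracketSpan μ ⊤ ⊤) j ≤
      (LieModule.lowerCentralSeries ℝ (LieAlgebra.derivedSeries ℝ E 1) E j).toSubmodule := by
    intro j
    induction j with
    | zero => simp
    | succ j ih =>
      refine Submodule.span_le.mpr ?_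
      rintro _ ⟨x, hx, y, hy, rfl⟩
      have hx' : x ∈ LieAlgebra.derivedSeries ℝ E 1 := by
        rw [← LieSubmodule.mem_toSubmodule, hder]
        exact hx
      rw [LieModule.lowerCentralSeries_succ]
      exact LieSubmodule.lie_mem_lie
        (LieSubmodule.mem_top (⟨x, hx'⟩ : LieAlgebra.derivedSeries ℝ E 1)) (ih hy)
  simpa [hk] using hle k

/-- The nilradical of a finite-dimensional solvable Lie algebra contains all brackets. -/
theorem IsNilradical.bracket_mem [FiniteDimensional ℝ E] (h : IsLieBracket μ)
    (hsolv : IsSolvableB μ) {n : Submodule ℝ E} (hn : IsNilradical μ n) (X Y : E) : μ X Y ∈ n :=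
  hn.2.2 _ (isIdeal_bracketSpan_top μ) (h.isNilpotentOn_bracketSpan_top hsolv)
    (Submodule.subset_span ⟨X, trivial, Y, trivial, rfl⟩)

theorem piAct_apply (f : E →ₗ[ℝ] E) (μ : E →ₗ[ℝ] E →ₗ[ℝ] E) (X Y : E) :
    piAct f μ X Y = f (μ X Y) - μ (f X) Y - μ X (f Y) := by
  simp [piAct]

theorem piAct_eq_zero_iff {f : E →ₗ[ℝ] E} {μ : E →ₗ[ℝ] E →ₗ[ℝ] E} :
    piAct f μ = 0 ↔ IsDeriv μ f := by
  simp only [LinearMap.ext_iff, piAct_apply, IsDeriv, LinearMap.zero_apply, sub_sub, sub_eq_zero]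

theorem piAct_comm {f g : E →ₗ[ℝ] E} (h : f ∘ₗ g = g ∘ₗ f) (μ : E →ₗ[ℝ] E →ₗ[ℝ] E) :
    piAct f (piAct g μ) = piAct g (piAct f μ) := by
  have h' : ∀ x, f (g x) = g (f x) := LinearMap.congr_fun h
  ext X Y
  simp only [piAct_apply, map_sub, h']
  abel

end Bracket

section Metric

variable {E : Type*} [NormedAddCommGroup E] [InnerProductSpace ℝ E] [FiniteDimensional ℝ E]

theorem transp_inner_left (f : E →ₗ[ℝ] E) (x y : E) : ⟪transp f x, y⟫ = ⟪x, f y⟫ :=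
  LinearMap.adjoint_inner_left f y x

theorem transp_inner_right (f : E →ₗ[ℝ] E) (x y : E) : ⟪x, transp f y⟫ = ⟪f x, y⟫ :=
  LinearMap.adjoint_inner_right f x y

theorem transp_transp (f : E →ₗ[ℝ] E) : transp (transp f) = f := LinearMap.adjoint_adjoint f

theorem sum_inner_comp_left {F : Type*} [NormedAddCommGroup F] [InnerProductSpace ℝ F]
    {ι : Type*} [Fintype ι] (b : OrthonormalBasis ι ℝ E) (f : E →ₗ[ℝ] E) (g h : E →ₗ[ℝ] F) :
    ∑ i, ⟪g (f (b i)), h (b i)⟫ = ∑ i, ⟪g (b i), h (transp f (b i))⟫ := by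
  have h1 : ∀ i, g (f (b i)) = ∑ k, ⟪b k, f (b i)⟫ • g (b k) := fun i ↦ by
    conv_lhs => rw [← b.sum_repr' (f (b i))]
    simp
  have h2 : ∀ i, h (transp f (b i)) = ∑ k, ⟪b k, transp f (b i)⟫ • h (b k) := fun i ↦ by
    conv_lhs => rw [← b.sum_repr' (transp f (b i))]
    simp
  simp only [h1, h2, sum_inner, inner_sum, real_inner_smul_left, real_inner_smul_right,
    transp_inner_right]
  rw [Finset.sum_comm]
  simp only [real_inner_comm]

theorem binner_piAct_left (f : E →ₗ[ℝ] E) (μ ν : E →ₗ[ℝ] E →ₗ[ℝ] E) :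
    binner (piAct f μ) ν = binner μ (piAct (transp f) ν) := by
  simp only [binner, piAct_apply, inner_sub_left, inner_sub_right, Finset.sum_sub_distrib,
    transp_inner_right]
  congr 1
  · congr 1
    rw [Finset.sum_comm, Finset.sum_comm (f := fun i j ↦ ⟪μ _ _, ν (transp f _) _⟫)]
    exact Finset.sum_congr rfl fun j _ ↦
      sum_inner_comp_left (stdONB E) f (μ.flip (stdONB E j)) (ν.flip (stdONB E j))
  · exact Finset.sum_congr rfl fun i _ ↦
      sum_inner_comp_left (stdONB E) f (μ (stdONB E i)) (ν (stdONB E i))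

theorem binner_self_eq_zero {μ : E →ₗ[ℝ] E →ₗ[ℝ] E} (h : binner μ μ = 0) : μ = 0 := by
  have hnn : ∀ i j, 0 ≤ ⟪μ (stdONB E i) (stdONB E j), μ (stdONB E i) (stdONB E j)⟫ :=
    fun _ _ ↦ real_inner_self_nonneg
  refine (stdONB E).toBasis.ext fun i ↦ (stdONB E).toBasis.ext fun j ↦ ?_
  have hi := (Finset.sum_eq_zero_iff_of_nonneg
    fun i _ ↦ Finset.sum_nonneg fun j _ ↦ hnn i j).mp h i (Finset.mem_univ i)
  have hij := (Finset.sum_eq_zero_iff_of_nonneg fun j _ ↦ hnn i j).mp hi j (Finset.mem_univ j)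
  simpa using hij

/-- The transpose of a normal derivation is a derivation. -/
theorem IsDeriv.transp_of_normal {μ : E →ₗ[ℝ] E →ₗ[ℝ] E} {D : E →ₗ[ℝ] E} (hD : IsDeriv μ D)
    (hnormal : D ∘ₗ transp D = transp D ∘ₗ D) : IsDeriv μ (transp D) := by
  rw [← piAct_eq_zero_iff]
  refine binner_self_eq_zero ?_
  rw [binner_piAct_left, transp_transp, piAct_comm hnormal, piAct_eq_zero_iff.mpr hD]
  simp [binner, piAct_apply]

end Metric

/-- for a metric solvable Lie algebra with nilradical `n` and `a = nᗮ`, and any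
`A ∈ a`, the transpose `(ad A)ᵗ` is a derivation if and only if `ad A` is a normal operator. -/
theorem adjoint_ad_deriv_iff_normal
    {E : Type*} [NormedAddCommGroup E] [InnerProductSpace ℝ E] [FiniteDimensional ℝ E]
    (μ : E →ₗ[ℝ] E →ₗ[ℝ] E) (hLie : IsLieBracket μ) (hsolv : IsSolvableB μ)
    (n : Submodule ℝ E) (hn : IsNilradical μ n)
    (A : E) (hA : A ∈ nᗮ) :
    IsDeriv μ (transp (μ A)) ↔ (μ A) ∘ₗ transp (μ A) = transp (μ A) ∘ₗ (μ A) := by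
  refine ⟨fun hD ↦ ?_, IsDeriv.transp_of_normal fun X Y ↦ hLie.2 A X Y⟩
  have hDA : transp (μ A) A = 0 := by
    rw [← inner_self_eq_zero (𝕜 := ℝ), transp_inner_left]
    exact (Submodule.mem_orthogonal' n A).mp hA _ (hn.bracket_mem hLie hsolv _ _)
  ext X
  simpa [hDA] using (hD A X).symm
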